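/- arXiv:1910.11588 — 4 statements merged into one kernel-verified Lean document; each statement's English description precedes it below -/
import Mathlib

section
/- Let a : Fin d → MvPolynomial (Fin d) ℝ be a tnn-update with induced map α. Then the n-fold iterate of α admits a poly-exponential closed form for large n: there exist N ∈ ℕ and, for each i : Fin d, a finite index set and families of polynomials α_{i,j} ∈ MvPolynomial (Fin d) ℝ, exponents e_{i,j} ∈ ℕ, and bases b_{i,j} ∈ ℝ with b_{i,j} > 0, such that for all c : Fin d → ℝ and all n ≥ N, (α^[n](c)) i = Σ_j (eval c α_{i,j}) · n^{e_{i,j}} · b_{i,j}^n. -/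
open MvPolynomial

/-- The dependence relation `≻_a`: transitive closure of
`{(i, j) | i ≠ j and j ∈ (a i).vars}`. -/
def depRel {d : ℕ} (a : Fin d → MvPolynomial (Fin d) ℝ) : Fin d → Fin d → Prop :=
  Relation.TransGen fun i j => i ≠ j ∧ j ∈ (a i).vars

/-- The map on points induced by an update: `α(c) i = eval c (a i)`. -/
noncomputable def updMap {d : ℕ} (a : Fin d → MvPolynomial (Fin d) ℝ)
    (c : Fin d → ℝ) (i : Fin d) : ℝ :=
  eval c (a i)

namespace TnnAux

abbrev P (d : ℕ) := MvPolynomial (Fin d) ℝ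

/-- The sequence `n ↦ n^e b^n` with values in the polynomial ring. -/
noncomputable def gen (d e : ℕ) (b : ℝ) : ℕ → P d := fun n => C ((n : ℝ) ^ e * b ^ n)

/-- The monoid of basic poly-exponential sequences. -/
noncomputable def G (d : ℕ) : Submonoid (ℕ → P d) where
  carrier := {f | ∃ (e : ℕ) (b : ℝ), 0 < b ∧ f = gen d e b}
  one_mem' := ⟨0, 1, one_pos, by funext n; simp [gen]⟩
  mul_mem' := by
    rintro _ _ ⟨e, b, hb, rfl⟩ ⟨e', b', hb', rfl⟩
    refine ⟨e + e', b * b', mul_pos hb hb', ?_⟩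
    funext n
    simp only [gen, Pi.mul_apply, ← C_mul]
    congr 1
    rw [pow_add, mul_pow]; ring

/-- Poly-exponential sequences with polynomial coefficients. -/
noncomputable def M (d : ℕ) : Subalgebra (P d) (ℕ → P d) := Algebra.adjoin (P d) (G d : Set (ℕ → P d))

lemma mem_M {d : ℕ} (f : ℕ → P d) :
    f ∈ M d ↔ f ∈ Submodule.span (P d) (G d : Set (ℕ → P d)) := by
  rw [← Subalgebra.mem_toSubmodule, M, Algebra.adjoin_eq_span, Submonoid.closure_eq]

lemma gen_mem {d e : ℕ} {b : ℝ} (hb : 0 < b) : gen d e b ∈ M d :=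
  Algebra.subset_adjoin ⟨e, b, hb, rfl⟩

/-- Eventually poly-exponential sequences. -/
noncomputable def E (d : ℕ) : Subalgebra (P d) (ℕ → P d) where
  carrier := {f | ∃ g ∈ M d, ∃ N : ℕ, ∀ n, N ≤ n → f n = g n}
  mul_mem' := by
    rintro f f' ⟨g, hg, N, h⟩ ⟨g', hg', N', h'⟩
    refine ⟨g * g', mul_mem hg hg', max N N', fun n hn => ?_⟩
    simp [h n (le_of_max_le_left hn), h' n (le_of_max_le_right hn)]
  add_mem' := by
    rintro f f' ⟨g, hg, N, h⟩ ⟨g', hg', N', h'⟩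
    refine ⟨g + g', add_mem hg hg', max N N', fun n hn => ?_⟩
    simp [h n (le_of_max_le_left hn), h' n (le_of_max_le_right hn)]
  algebraMap_mem' := fun r => ⟨_, (M d).algebraMap_mem r, 0, fun _ _ => rfl⟩

/-- `T_c y = g` is solvable. -/
def Solv {d : ℕ} (c : ℝ) (g : ℕ → P d) : Prop :=
  ∃ y ∈ M d, ∀ n, y (n + 1) = C c * y n + g n

lemma Solv.add {d : ℕ} {c : ℝ} {g g' : ℕ → P d} (h : Solv c g) (h' : Solv c g') :
    Solv c (g + g') := by
  obtain ⟨y, hy, h⟩ := h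
  obtain ⟨y', hy', h'⟩ := h'
  refine ⟨y + y', add_mem hy hy', fun n => ?_⟩
  simp only [Pi.add_apply, h, h']; ring

lemma Solv.smul {d : ℕ} {c : ℝ} {g : ℕ → P d} (r : P d) (h : Solv c g) :
    Solv c (r • g) := by
  obtain ⟨y, hy, h⟩ := h
  refine ⟨r • y, Subalgebra.smul_mem _ hy r, fun n => ?_⟩
  simp only [Pi.smul_apply, smul_eq_mul, h]; ring

lemma Solv.zero {d : ℕ} {c : ℝ} : Solv c (0 : ℕ → P d) :=
  ⟨0, zero_mem _, fun n => by simp⟩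

lemma Solv.sum {d : ℕ} {c : ℝ} {ι : Type} (s : Finset ι) (g : ι → ℕ → P d)
    (h : ∀ i ∈ s, Solv c (g i)) : Solv c (∑ i ∈ s, g i) := by
  classical
  induction s using Finset.induction_on with
  | empty => simpa using Solv.zero
  | insert a s ha ih =>
    rw [Finset.sum_insert ha]
    exact (h a (by simp)).add (ih fun i hi => h i (by simp [hi]))

/-- key: if `T_c` of a generator equals `k g + Σ lower`, solve for `g`. -/
lemma Solv.of_lower {d : ℕ} {c b : ℝ} (e E' : ℕ) (hb : 0 < b) (k : ℝ) (hk : k ≠ 0) (u : ℕ → ℝ)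
    (H : ∀ n : ℕ, b * ((n : ℝ) + 1) ^ E' - c * (n : ℝ) ^ E' =
      k * (n : ℝ) ^ e + ∑ m ∈ Finset.range e, u m * (n : ℝ) ^ m)
    (ih : ∀ m < e, Solv c (gen d m b)) : Solv c (gen d e b) := by
  have h1 : Solv c (gen d e b + (C k⁻¹ : P d) • ∑ m ∈ Finset.range e, (C (u m) : P d) • gen d m b) := by
    refine ⟨(C k⁻¹ : P d) • gen d E' b, Subalgebra.smul_mem _ (gen_mem hb) _, fun n => ?_⟩
    simp only [gen, Pi.add_apply, Pi.smul_apply, Finset.sum_apply, smul_eq_mul, ← C_mul,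
      ← map_sum, ← C_add]
    congr 1
    have := H n
    have h2 : ∑ m ∈ Finset.range e, u m * ((n : ℝ) ^ m * b ^ n) =
      (∑ m ∈ Finset.range e, u m * (n : ℝ) ^ m) * b ^ n := by
      rw [Finset.sum_mul]; exact Finset.sum_congr rfl fun m _ => by ring
    rw [h2, eq_sub_of_add_eq' this.symm]
    push_cast
    field_simp
    ring
  have h3 : Solv c (∑ m ∈ Finset.range e, (C (u m) : P d) • gen d m b) :=
    Solv.sum _ _ fun m hm => (ih m (Finset.mem_range.1 hm)).smul _
  have h4 := h1.add ((h3.smul (C k⁻¹ : P d)).smul (-1))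
  convert h4 using 1
  rw [neg_one_smul]; abel

lemma solv_gen {d : ℕ} (c b : ℝ) (hb : 0 < b) (e : ℕ) : Solv c (gen d e b) := by
  induction e using Nat.strong_induction_on with
  | _ e ih =>
    by_cases hbc : b = c
    · subst hbc
      refine Solv.of_lower e (e + 1) hb (b * (e + 1)) (by positivity)
        (fun m => b * ((e + 1).choose m : ℝ)) (fun n => ?_) ih
      rw [add_pow, Finset.sum_range_succ, Finset.sum_range_succ]
      simp only [one_pow, mul_one, Nat.choose_self, Nat.choose_succ_self_right]
      rw [mul_add, mul_add, Finset.mul_sum]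
      push_cast
      rw [Finset.sum_congr rfl (fun m _ => (by ring : b * ((n : ℝ) ^ m * ((e + 1).choose m : ℝ)) = b * ((e + 1).choose m : ℝ) * (n : ℝ) ^ m))]
      ring
    · refine Solv.of_lower e e hb (b - c) (sub_ne_zero.2 hbc)
        (fun m => b * (e.choose m : ℝ)) (fun n => ?_) ih
      rw [add_pow, Finset.sum_range_succ]
      simp only [one_pow, mul_one, Nat.choose_self]
      rw [mul_add, Finset.mul_sum]
      push_cast
      rw [Finset.sum_congr rfl (fun m _ => (by ring : b * ((n : ℝ) ^ m * (e.choose m : ℝ)) = b * (e.choose m : ℝ) * (n : ℝ) ^ m))]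
      ring

lemma solv_M {d : ℕ} (c : ℝ) (g : ℕ → P d) (hg : g ∈ M d) : Solv c g := by
  rw [mem_M] at hg
  induction hg using Submodule.span_induction with
  | mem x h => obtain ⟨e, b, hb, rfl⟩ := h; exact solv_gen c b hb e
  | zero => exact Solv.zero
  | add x y _ _ hx hy => exact hx.add hy
  | smul r x _ hx => exact hx.smul r

lemma recur {d : ℕ} (c : ℝ) (hc : 0 ≤ c) (x r : ℕ → P d) (hr : r ∈ E d)
    (h : ∀ n, x (n + 1) = C c * x n + r n) : x ∈ E d := by
  obtain ⟨g, hg, N, hN⟩ := hr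
  obtain ⟨y, hy, hyr⟩ := solv_M c g hg
  have key : ∀ k, x (N + k) = y (N + k) + C (c ^ k) * (x N - y N) := by
    intro k
    induction k with
    | zero => simp
    | succ k ih =>
      rw [← add_assoc, h, hyr, ih, hN _ (by omega), pow_succ, C_mul]; ring
  rcases hc.eq_or_lt with rfl | hc
  · refine ⟨y, hy, N + 1, fun n hn => ?_⟩
    obtain ⟨k, rfl⟩ := Nat.exists_eq_add_of_le hn
    have := key (1 + k)
    rw [← add_assoc] at this
    rw [this]; simp
  · refine ⟨y + (C (c ^ N)⁻¹ * (x N - y N)) • gen d 0 c,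
      add_mem hy (Subalgebra.smul_mem _ (gen_mem hc) _), N, fun n hn => ?_⟩
    obtain ⟨k, rfl⟩ := Nat.exists_eq_add_of_le hn
    rw [key k]
    simp only [Pi.add_apply, Pi.smul_apply, smul_eq_mul, gen]
    have : c ^ k = (c ^ N)⁻¹ * (((N + k : ℕ) : ℝ) ^ 0 * c ^ (N + k)) := by
      rw [pow_add]; field_simp
    rw [this, C_mul]; ring

/-- symbolic iterates -/
noncomputable def q {d : ℕ} (a : Fin d → P d) : ℕ → Fin d → P d
  | 0 => X
  | n + 1 => fun i => bind₁ (q a n) (a i)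

lemma eval_q {d : ℕ} (a : Fin d → P d) (c : Fin d → ℝ) (n : ℕ) (i : Fin d) :
    eval c (q a n i) = (updMap a)^[n] c i := by
  induction n generalizing i with
  | zero => simp [q]
  | succ n ih =>
    rw [Function.iterate_succ_apply', updMap, q, ← funext ih]
    simp only [← coe_aeval_eq_eval]
    exact aeval_bind₁ _ _ _

lemma bind_mem {d : ℕ} (Q : ℕ → Fin d → P d) (p : P d)
    (h : ∀ j ∈ p.vars, (fun n => Q n j) ∈ E d) : (fun n => bind₁ (Q n) p) ∈ E d := by
  have : (fun n => bind₁ (Q n) p) = ∑ m ∈ p.support,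
      (C (coeff m p) : P d) • ∏ j ∈ m.support, (fun n => Q n j) ^ m j := by
    funext n
    rw [bind₁, aeval_def, eval₂_eq]
    simp [Finset.sum_apply, Finset.prod_apply, algebraMap_eq]
  rw [this]
  refine sum_mem fun m hm => Subalgebra.smul_mem _ (prod_mem fun j hj => pow_mem (h j ?_) _) _
  exact (mem_vars j).2 ⟨m, hm, hj⟩

lemma q_mem {d : ℕ} (a : Fin d → P d)
    (hwf : WellFounded (depRel a))
    (htnn : ∀ i, ∃ (ci : ℝ) (pi : P d),
      0 ≤ ci ∧ i ∉ pi.vars ∧ a i = ci • X i + pi) (i : Fin d) :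
    (fun n => q a n i) ∈ E d := by
  have hw : WellFounded (Function.swap (depRel a)) := by
    have : IsTrans (Fin d) (Function.swap (depRel a)) :=
      ⟨fun x y z h1 h2 => Relation.TransGen.trans h2 h1⟩
    have : Std.Irrefl (Function.swap (depRel a)) :=
      ⟨fun x h => hwf.irrefl.irrefl x h⟩
    exact Finite.wellFounded_of_trans_of_irrefl _
  induction i using hw.induction with
  | _ i ih =>
    obtain ⟨c, p, hc, hp, ha⟩ := htnn i
    refine recur c hc _ (fun n => bind₁ (q a n) p) (bind_mem _ _ fun j hj => ih j ?_) fun n => ?_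
    · refine Relation.TransGen.single ⟨fun h => hp (h ▸ hj), ?_⟩
      obtain ⟨m, hm, hmj⟩ := (mem_vars j).1 hj
      refine (mem_vars j).2 ⟨m, ?_, hmj⟩
      have hmi : Finsupp.single i 1 ≠ m := by
        rintro rfl
        exact hp ((mem_vars i).2 ⟨_, hm, by simp⟩)
      rw [mem_support_iff] at hm ⊢
      rw [ha, coeff_add, coeff_smul, coeff_X', if_neg hmi]
      simpa using hm
    · simp only [q]
      rw [ha, map_add, map_smul, bind₁_X_right, smul_eq_C_mul]

end TnnAux

/-- A tnn-update admits a poly-exponential closed form for large `n`: there are `N` and,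
for each coordinate `i`, finitely many polynomials `A j`, exponents `e j` and positive
bases `b j` such that for all points `c` and all `n ≥ N`,
`(α^[n] c) i = Σ_j (eval c (A j)) · n^(e j) · (b j)^n`. -/
theorem tnn_closed_form {d : ℕ} (hd : 1 ≤ d) (a : Fin d → MvPolynomial (Fin d) ℝ)
    (hwf : WellFounded (depRel a))
    (htnn : ∀ i, ∃ (ci : ℝ) (pi : MvPolynomial (Fin d) ℝ),
      0 ≤ ci ∧ i ∉ pi.vars ∧ a i = ci • X i + pi) :
    ∃ N : ℕ, ∀ i : Fin d, ∃ (m : ℕ) (A : Fin m → MvPolynomial (Fin d) ℝ)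
      (e : Fin m → ℕ) (b : Fin m → ℝ),
      (∀ j, 0 < b j) ∧
      ∀ (c : Fin d → ℝ) (n : ℕ), N ≤ n →
        (updMap a)^[n] c i = ∑ j, eval c (A j) * (n : ℝ) ^ (e j) * (b j) ^ n := by
  have H := fun i => TnnAux.q_mem a hwf htnn i
  choose g hg N hN using H
  beta_reduce at hN
  refine ⟨Finset.univ.sup N, fun i => ?_⟩
  have h1 := (TnnAux.mem_M _).1 (hg i)
  obtain ⟨m, A, f, hf⟩ := Submodule.mem_span_set'.1 h1
  choose e b hb hfe using fun j => (f j).2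
  refine ⟨m, A, e, b, hb, fun c n hn => ?_⟩
  rw [← TnnAux.eval_q, hN i n ((Finset.le_sup (Finset.mem_univ i)).trans hn), ← hf,
    Finset.sum_apply, map_sum]
  refine Finset.sum_congr rfl fun j _ => ?_
  rw [Pi.smul_apply, hfe j, smul_eq_mul, map_mul, TnnAux.gen, eval_C, mul_assoc]
end

section
/- Let a : Fin d → MvPolynomial (Fin d) ℝ be a tnn-update with induced map α. Then for every polynomial p ∈ MvPolynomial (Fin d) ℝ and every c : Fin d → ℝ, the truth value of the inequality along the trajectory is eventually constant: there exists N ∈ ℕ such that either eval (α^[n](c)) p > 0 for all n ≥ N, or eval (α^[n](c)) p ≤ 0 for all n ≥ N. -/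
open MvPolynomial

/-- Exponential monomials `n ^ k * exp (s * n)`. -/
noncomputable def expMon (q : ℝ ×ₗ ℕ) : ℕ → ℝ :=
  fun n => (n : ℝ) ^ (ofLex q).2 * (Real.exp (ofLex q).1) ^ n

/-- Span of the exponential monomials. -/
noncomputable def expSpan : Submodule ℝ (ℕ → ℝ) := Submodule.span ℝ (Set.range expMon)

lemma expMon_mem (q) : expMon q ∈ expSpan := Submodule.subset_span ⟨q, rfl⟩

lemma expSpan_mul {f g : ℕ → ℝ} (hf : f ∈ expSpan) (hg : g ∈ expSpan) : f * g ∈ expSpan := by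
  have h : expSpan * expSpan ≤ expSpan := by
    unfold expSpan
    rw [Submodule.span_mul_span]
    apply Submodule.span_mono
    rintro _ ⟨_, ⟨q, rfl⟩, _, ⟨r, rfl⟩, rfl⟩
    refine ⟨toLex ((ofLex q).1 + (ofLex r).1, (ofLex q).2 + (ofLex r).2), ?_⟩
    funext n
    simp only [expMon, ofLex_toLex, Pi.mul_apply, Real.exp_add]
    ring
  exact h (Submodule.mul_mem_mul hf hg)

lemma expSpan_const (r : ℝ) : (fun _ => r) ∈ expSpan := by
  have := expSpan.smul_mem r (expMon_mem (toLex (0, 0)))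
  convert this using 1
  funext n
  simp [expMon]

/-- Sequences eventually equal to a combination of exponential monomials. -/
noncomputable def evExp : Subalgebra ℝ (ℕ → ℝ) where
  carrier := {x | ∃ f ∈ expSpan, ∀ᶠ n in Filter.atTop, x n = f n}
  mul_mem' := by
    rintro x y ⟨f, hf, hx⟩ ⟨g, hg, hy⟩
    refine ⟨f * g, expSpan_mul hf hg, ?_⟩
    filter_upwards [hx, hy] with n h1 h2
    simp [h1, h2]
  add_mem' := by
    rintro x y ⟨f, hf, hx⟩ ⟨g, hg, hy⟩
    refine ⟨f + g, expSpan.add_mem hf hg, ?_⟩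
    filter_upwards [hx, hy] with n h1 h2
    simp [h1, h2]
  algebraMap_mem' := by
    intro r
    exact ⟨_, expSpan_const r, Filter.Eventually.of_forall fun n => rfl⟩

lemma expMon_isLittleO {q r : ℝ ×ₗ ℕ} (h : q < r) :
    expMon q =o[Filter.atTop] expMon r := by
  rw [Prod.Lex.lt_iff] at h
  rcases h with h | ⟨h1, h2⟩
  · have h3 : expMon q =o[Filter.atTop] fun n : ℕ => Real.exp (ofLex r).1 ^ n :=
      isLittleO_pow_const_mul_const_pow_const_pow_of_norm_lt (ofLex q).2
        (by rw [Real.norm_eq_abs, abs_of_pos (Real.exp_pos _)]; exact Real.exp_lt_exp.2 h)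
    refine h3.trans_isBigO ?_
    refine Asymptotics.IsBigO.of_bound 1 ?_
    filter_upwards [Filter.eventually_ge_atTop 1] with n hn
    have hn' : (1 : ℝ) ≤ n := by exact_mod_cast hn
    have := one_le_pow₀ hn' (n := (ofLex r).2)
    have h5 : 0 < Real.exp (ofLex r).1 ^ n := by positivity
    unfold expMon
    rw [Real.norm_eq_abs, Real.norm_eq_abs, abs_of_pos h5, abs_of_pos (by positivity)]
    nlinarith
  · have h3 : (fun n : ℕ => (n : ℝ) ^ (ofLex q).2) =o[Filter.atTop]
        fun n : ℕ => (n : ℝ) ^ (ofLex r).2 :=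
      (Asymptotics.isLittleO_pow_pow_atTop_of_lt (𝕜 := ℝ) h2).comp_tendsto
        tendsto_natCast_atTop_atTop
    unfold expMon
    rw [h1]
    exact h3.mul_isBigO (Asymptotics.isBigO_refl _ _)

lemma expSpan_sign {f : ℕ → ℝ} (hf : f ∈ expSpan) :
    (∀ᶠ n in Filter.atTop, 0 < f n) ∨ (∀ᶠ n in Filter.atTop, f n ≤ 0) := by
  classical
  unfold expSpan at hf
  rw [Finsupp.mem_span_range_iff_exists_finsupp] at hf
  obtain ⟨l, rfl⟩ := hf
  by_cases hl : l.support.Nonempty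
  · obtain ⟨m, hm, hmax⟩ := l.support.exists_max_image id hl
    have hrest : (fun n => ∑ q ∈ l.support.erase m, l q * expMon q n) =o[Filter.atTop]
        expMon m := by
      refine Asymptotics.IsLittleO.fun_sum (A := fun q n => l q * expMon q n) fun q hq => ?_
      refine (expMon_isLittleO ?_).const_mul_left _
      rw [Finset.mem_erase] at hq
      exact lt_of_le_of_ne (hmax q hq.2) hq.1
    have hlm : l m ≠ 0 := by simpa using hm
    have hb := hrest.bound (show 0 < |l m| / 2 by positivity)
    have key : ∀ n, (l.sum fun i a => a • expMon i) n =
        l m * expMon m n + ∑ q ∈ l.support.erase m, l q * expMon q n := by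
      intro n
      rw [Finsupp.sum, Finset.sum_apply, ← Finset.add_sum_erase _ _ hm]
      simp
    simp only [key]
    have hpos : ∀ᶠ n in Filter.atTop, 0 < expMon m n := by
      filter_upwards [Filter.eventually_ge_atTop 1] with n hn
      have hn' : (0 : ℝ) < n := by exact_mod_cast hn
      unfold expMon
      positivity
    rcases lt_or_gt_of_ne hlm with h | h
    · right
      filter_upwards [hb, hpos] with n h1 h2
      rw [Real.norm_eq_abs, Real.norm_eq_abs, abs_of_pos h2, abs_of_neg h] at h1
      have := (abs_le.1 h1).2
      nlinarith
    · left
      filter_upwards [hb, hpos] with n h1 h2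
      rw [Real.norm_eq_abs, Real.norm_eq_abs, abs_of_pos h2, abs_of_pos h] at h1
      have := (abs_le.1 h1).1
      nlinarith
  · right
    rw [Finset.not_nonempty_iff_eq_empty, Finsupp.support_eq_empty] at hl
    subst hl
    simp

/-- The operator `g ↦ g (n+1) - c * g n`. -/
def shiftOp (c : ℝ) : (ℕ → ℝ) →ₗ[ℝ] (ℕ → ℝ) where
  toFun g := fun n => g (n + 1) - c * g n
  map_add' := by intro f g; funext n; simp; ring
  map_smul' := by intro r g; funext n; simp; ring

lemma expMon_solve {c : ℝ} (s : ℝ) (k : ℕ) :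
    expMon (toLex (s, k)) ∈ expSpan.map (shiftOp c) := by
  induction k using Nat.strong_induction_on with
  | _ k ih =>
    have hs := Real.exp_pos s
    by_cases hc : Real.exp s = c
    · have h1 : shiftOp c (expMon (toLex (s, k + 1))) ∈ expSpan.map (shiftOp c) :=
        Submodule.mem_map_of_mem (expMon_mem _)
      have h2 : (∑ j ∈ Finset.range k, (c * ((k + 1).choose j : ℝ)) • expMon (toLex (s, j))) ∈
          expSpan.map (shiftOp c) :=
        Submodule.sum_mem _ fun j hj => Submodule.smul_mem _ _ (ih j (Finset.mem_range.1 hj))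
      have h3 := Submodule.smul_mem _ (c * (k + 1))⁻¹ (Submodule.sub_mem _ h1 h2)
      convert h3 using 1
      funext n
      have hcpos : 0 < c := hc ▸ hs
      have hk : (k : ℝ) + 1 ≠ 0 := by positivity
      simp only [shiftOp, expMon, LinearMap.coe_mk, AddHom.coe_mk, ofLex_toLex, Pi.smul_apply,
        Pi.sub_apply, Finset.sum_apply, smul_eq_mul, hc]
      push_cast
      rw [add_pow, Finset.sum_range_succ, Finset.sum_range_succ]
      simp only [one_pow, mul_one, Nat.choose_self, Nat.choose_succ_self_right]
      push_cast
      have e : ∑ j ∈ Finset.range k, c * ((k + 1).choose j : ℝ) * ((n : ℝ) ^ j * c ^ n) =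
          (∑ j ∈ Finset.range k, (n : ℝ) ^ j * ((k + 1).choose j : ℝ)) * c ^ (n + 1) := by
        rw [Finset.sum_mul]
        exact Finset.sum_congr rfl fun j _ => by ring
      rw [e]
      field_simp
      ring
    · have h1 : shiftOp c (expMon (toLex (s, k))) ∈ expSpan.map (shiftOp c) :=
        Submodule.mem_map_of_mem (expMon_mem _)
      have h2 : (∑ j ∈ Finset.range k,
          (Real.exp s * (k.choose j : ℝ)) • expMon (toLex (s, j))) ∈
          expSpan.map (shiftOp c) :=
        Submodule.sum_mem _ fun j hj => Submodule.smul_mem _ _ (ih j (Finset.mem_range.1 hj))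
      have h3 := Submodule.smul_mem _ (Real.exp s - c)⁻¹ (Submodule.sub_mem _ h1 h2)
      convert h3 using 1
      funext n
      have hk : Real.exp s - c ≠ 0 := sub_ne_zero.2 hc
      simp only [shiftOp, expMon, LinearMap.coe_mk, AddHom.coe_mk, ofLex_toLex, Pi.smul_apply,
        Pi.sub_apply, Finset.sum_apply, smul_eq_mul]
      push_cast
      rw [add_pow, Finset.sum_range_succ]
      simp only [one_pow, mul_one, Nat.choose_self]
      push_cast
      have e : ∑ j ∈ Finset.range k, Real.exp s * (k.choose j : ℝ) *
            ((n : ℝ) ^ j * Real.exp s ^ n) =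
          (∑ j ∈ Finset.range k, (n : ℝ) ^ j * (k.choose j : ℝ)) * Real.exp s ^ (n + 1) := by
        rw [Finset.sum_mul]
        exact Finset.sum_congr rfl fun j _ => by ring
      rw [e, eq_inv_mul_iff_mul_eq₀ hk]
      ring

lemma expSpan_solve (c : ℝ) : expSpan ≤ expSpan.map (shiftOp c) := by
  conv_lhs => unfold expSpan
  rw [Submodule.span_le]
  rintro _ ⟨q, rfl⟩
  exact expMon_solve (ofLex q).1 (ofLex q).2

lemma evExp_solve {c : ℝ} (hc : 0 ≤ c) {x y : ℕ → ℝ} (hy : y ∈ evExp)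
    (hx : ∀ n, x (n + 1) = c * x n + y n) : x ∈ evExp := by
  obtain ⟨f, hf, hyf⟩ := hy
  obtain ⟨g, hg, rfl⟩ := expSpan_solve c hf
  obtain ⟨N, hN⟩ := Filter.eventually_atTop.1 hyf
  have hrec : ∀ m, x (N + m) - g (N + m) = c ^ m * (x N - g N) := by
    intro m
    induction m with
    | zero => simp
    | succ m ih =>
      have h1 := hx (N + m)
      have h2 := hN (N + m) (by omega)
      simp only [shiftOp, LinearMap.coe_mk, AddHom.coe_mk] at h2
      rw [← add_assoc, h1, h2, pow_succ]
      linear_combination c * ih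
  rcases hc.eq_or_lt with rfl | hc
  · refine ⟨g, hg, ?_⟩
    filter_upwards [Filter.eventually_ge_atTop (N + 1)] with n hn
    obtain ⟨m, rfl⟩ := Nat.exists_eq_add_of_le hn
    have := hrec (m + 1)
    rw [pow_succ, mul_zero, zero_mul, sub_eq_zero] at this
    rwa [show N + 1 + m = N + (m + 1) by omega]
  · refine ⟨g + ((x N - g N) / c ^ N) • expMon (toLex (Real.log c, 0)),
      expSpan.add_mem hg (expSpan.smul_mem _ (expMon_mem _)), ?_⟩
    filter_upwards [Filter.eventually_ge_atTop N] with n hn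
    obtain ⟨m, rfl⟩ := Nat.exists_eq_add_of_le hn
    have := hrec m
    simp only [expMon, Pi.add_apply, Pi.smul_apply, ofLex_toLex, smul_eq_mul, pow_zero, one_mul,
      Real.exp_log hc]
    rw [pow_add]
    field_simp
    linarith

lemma evExp_eval {d : ℕ} (x : ℕ → Fin d → ℝ) (p : MvPolynomial (Fin d) ℝ)
    (h : ∀ i ∈ p.vars, (fun n => x n i) ∈ evExp) : (fun n => eval (x n) p) ∈ evExp := by
  have e : (fun n => eval (x n) p) = ∑ m ∈ p.support,
      (coeff m p) • ∏ i ∈ m.support, (fun n => x n i) ^ (m i) := by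
    funext n
    rw [eval_eq]
    simp [Finset.sum_apply, Finset.prod_apply]
  rw [e]
  refine sum_mem fun m hm => evExp.smul_mem (prod_mem fun i hi => pow_mem (h i ?_) _) _
  exact (mem_vars i).2 ⟨m, hm, hi⟩

/-- Along the trajectory of a tnn-loop, the truth value of a polynomial inequality is
eventually constant: there is `N` such that either `eval (α^[n] c) p > 0` for all `n ≥ N`,
or `eval (α^[n] c) p ≤ 0` for all `n ≥ N`. -/
theorem tnn_eventually_constant_sign {d : ℕ} (hd : 1 ≤ d)
    (a : Fin d → MvPolynomial (Fin d) ℝ)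
    (hwf : WellFounded (depRel a))
    (htnn : ∀ i, ∃ (ci : ℝ) (pi : MvPolynomial (Fin d) ℝ),
      0 ≤ ci ∧ i ∉ pi.vars ∧ a i = ci • X i + pi)
    (p : MvPolynomial (Fin d) ℝ) (c : Fin d → ℝ) :
    ∃ N : ℕ, (∀ n : ℕ, N ≤ n → 0 < eval ((updMap a)^[n] c) p) ∨
      (∀ n : ℕ, N ≤ n → eval ((updMap a)^[n] c) p ≤ 0) := by
  have hirr : ∀ i, ¬ depRel a i i := fun i hi => hwf.irrefl.irrefl i hi
  let R : Fin d → Fin d → Prop := fun i j => depRel a j i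
  haveI : IsTrans (Fin d) R := ⟨fun i j k h1 h2 => Relation.TransGen.trans h2 h1⟩
  haveI : Std.Irrefl R := ⟨hirr⟩
  have hR : WellFounded R := Finite.wellFounded_of_trans_of_irrefl R
  have hall : ∀ i, (fun n => (updMap a)^[n] c i) ∈ evExp := by
    intro i
    induction i using hR.induction with
    | _ i ih =>
      obtain ⟨ci, pi, hci, hpi, hai⟩ := htnn i
      refine evExp_solve hci (evExp_eval (fun n => (updMap a)^[n] c) pi ?_) ?_
      · intro j hj
        have hij : i ≠ j := by rintro rfl; exact hpi hj
        refine ih j (Relation.TransGen.single ⟨hij, ?_⟩)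
        obtain ⟨m, hm, hjm⟩ := (mem_vars j).1 hj
        refine (mem_vars j).2 ⟨m, ?_, hjm⟩
        rw [mem_support_iff] at hm ⊢
        have hne : Finsupp.single i 1 ≠ m := by
          rintro rfl
          rw [Finsupp.mem_support_iff, Finsupp.single_apply, if_neg hij] at hjm
          exact hjm rfl
        rw [hai, coeff_add, coeff_smul, coeff_X', if_neg hne]
        simpa using hm
      · intro n
        simp only [Function.iterate_succ_apply']
        conv_lhs => rw [updMap, hai]
        simp [smul_eval]
  obtain ⟨f, hf, hpf⟩ := evExp_eval (fun n => (updMap a)^[n] c) p fun i _ => hall i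
  rcases expSpan_sign hf with h | h
  · obtain ⟨N, hN⟩ := Filter.eventually_atTop.1 (hpf.and h)
    exact ⟨N, Or.inl fun n hn => (hN n hn).2.trans_eq (hN n hn).1.symm⟩
  · obtain ⟨N, hN⟩ := Filter.eventually_atTop.1 (hpf.and h)
    exact ⟨N, Or.inr fun n hn => (hN n hn).1.trans_le (hN n hn).2⟩
end

section
/- Let a : Fin d → MvPolynomial (Fin d) ℝ be a tnn-update with induced map α, and let S, S' ⊆ (Fin d → ℝ) be semialgebraic guards given in disjunctive normal form, i.e., each of S and S' is a finite union of finite intersections of sets of the form {x | eval x p > 0} or {x | eval x p ≥ 0} with p ∈ MvPolynomial (Fin d) ℝ. Then the loop with guard S ∪ S' is non-terminating (there exists c with α^[n](c) ∈ S ∪ S' for all n ∈ ℕ) if and only if the loop with guard S is non-terminating or the loop with guard S' is non-terminating. Equivalently, the tnn-loop with guard S ∪ S' terminates iff both the loop with guard S and the loop with guard S' terminate. -/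
open MvPolynomial

/-- A guard in disjunctive normal form: a finite union of finite intersections of sets of
the form `{x | eval x p > 0}` or `{x | eval x p ≥ 0}`. -/
def IsDNFGuard {d : ℕ} (S : Set (Fin d → ℝ)) : Prop :=
  ∃ (m : ℕ) (k : Fin m → ℕ) (p : (i : Fin m) → Fin (k i) → MvPolynomial (Fin d) ℝ)
    (strict : (i : Fin m) → Fin (k i) → Bool),
    S = ⋃ i, ⋂ j, {x | if strict i j then 0 < eval x (p i j) else 0 ≤ eval x (p i j)}

open Filter in
/-- Sequences eventually annihilated by a product of operators `shift - c` with `c ≥ 0`. -/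
inductive ExpPoly : (ℕ → ℝ) → Prop
  | zero (f : ℕ → ℝ) (h : ∀ᶠ n in atTop, f n = 0) : ExpPoly f
  | step (f : ℕ → ℝ) (c : ℝ) (hc : 0 ≤ c) (h : ExpPoly fun n => f (n + 1) - c * f n) : ExpPoly f

open Filter

lemma eventually_succ {P : ℕ → Prop} (h : ∀ᶠ n in atTop, P n) : ∀ᶠ n in atTop, P (n + 1) :=
  (tendsto_add_atTop_nat 1).eventually h

lemma ExpPoly.congr {f : ℕ → ℝ} (hf : ExpPoly f) :
    ∀ g : ℕ → ℝ, (∀ᶠ n in atTop, f n = g n) → ExpPoly g := by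
  induction hf with
  | zero f h =>
    intro g hg
    refine .zero g ?_
    filter_upwards [h, hg] with n h1 h2
    rw [← h2, h1]
  | step f c hc h ih =>
    intro g hg
    refine .step g c hc (ih _ ?_)
    filter_upwards [hg, eventually_succ hg] with n h1 h2
    rw [h1, h2]

lemma ExpPoly.smul {f : ℕ → ℝ} (hf : ExpPoly f) (r : ℝ) : ExpPoly fun n => r * f n := by
  induction hf with
  | zero f h =>
    refine .zero _ ?_
    filter_upwards [h] with n h1
    rw [h1, mul_zero]
  | step f c hc h ih =>
    refine .step _ c hc (ih.congr _ (Eventually.of_forall fun n => ?_))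
    ring

lemma ExpPoly.op {f : ℕ → ℝ} (hf : ExpPoly f) (r : ℝ) :
    ExpPoly fun n => f (n + 1) - r * f n := by
  induction hf with
  | zero f h =>
    refine .zero _ ?_
    filter_upwards [h, eventually_succ h] with n h1 h2
    rw [h1, h2]; ring
  | step f c hc h ih =>
    refine .step _ c hc (ih.congr _ (Eventually.of_forall fun n => ?_))
    ring

lemma ExpPoly.add {f : ℕ → ℝ} (hf : ExpPoly f) :
    ∀ g : ℕ → ℝ, ExpPoly g → ExpPoly fun n => f n + g n := by
  induction hf with
  | zero f h =>
    intro g hg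
    refine hg.congr _ ?_
    filter_upwards [h] with n h1
    rw [h1, zero_add]
  | step f c hc h ih =>
    intro g hg
    refine .step _ c hc ((ih _ (hg.op c)).congr _ (Eventually.of_forall fun n => ?_))
    ring

lemma ExpPoly.mul {f : ℕ → ℝ} (hf : ExpPoly f) :
    ∀ g : ℕ → ℝ, ExpPoly g → ExpPoly fun n => f n * g n := by
  induction hf with
  | zero f h =>
    intro g hg
    refine .zero _ ?_
    filter_upwards [h] with n h1
    rw [h1, zero_mul]
  | step f c hc h ih =>
    intro g hg
    induction hg with
    | zero g h =>
      refine .zero _ ?_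
      filter_upwards [h] with n h1
      rw [h1, mul_zero]
    | step g c' hc' h' ih' =>
      refine .step _ (c * c') (mul_nonneg hc hc') ?_
      have h1 := ih _ h'
      have h2 := (ih _ (ExpPoly.step g c' hc' h')).smul c'
      have h3 := ih'.smul c
      refine ((h1.add _ h2).add _ h3).congr _ (Eventually.of_forall fun n => ?_)
      ring

lemma ExpPoly.const (r : ℝ) : ExpPoly fun _ => r :=
  .step _ 1 zero_le_one (.zero _ (Eventually.of_forall fun n => by ring))

lemma ExpPoly.pow {f : ℕ → ℝ} (hf : ExpPoly f) (k : ℕ) : ExpPoly fun n => f n ^ k := by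
  induction k with
  | zero => simpa using ExpPoly.const 1
  | succ k ih => simpa only [pow_succ] using ih.mul _ hf

lemma ExpPoly.prod {ι : Type*} (s : Finset ι) (f : ι → ℕ → ℝ) (h : ∀ i ∈ s, ExpPoly (f i)) :
    ExpPoly fun n => ∏ i ∈ s, f i n := by
  classical
  induction s using Finset.induction_on with
  | empty => simpa using ExpPoly.const 1
  | insert i s hi ih =>
    simp only [Finset.prod_insert hi]
    exact (h i (by simp)).mul _ (ih fun j hj => h j (by simp [hj]))

lemma ExpPoly.sum {ι : Type*} (s : Finset ι) (f : ι → ℕ → ℝ) (h : ∀ i ∈ s, ExpPoly (f i)) :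
    ExpPoly fun n => ∑ i ∈ s, f i n := by
  classical
  induction s using Finset.induction_on with
  | empty => simpa using ExpPoly.const 0
  | insert i s hi ih =>
    simp only [Finset.sum_insert hi]
    exact (h i (by simp)).add _ (ih fun j hj => h j (by simp [hj]))

lemma ExpPoly.eval {d : ℕ} (p : MvPolynomial (Fin d) ℝ) (x : ℕ → Fin d → ℝ)
    (h : ∀ i ∈ p.vars, ExpPoly fun n => x n i) :
    ExpPoly fun n => MvPolynomial.eval (x n) p := by
  simp only [MvPolynomial.eval_eq]
  refine ExpPoly.sum _ (fun m n => coeff m p * ∏ i ∈ m.support, x n i ^ m i) fun m hm => ?_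
  refine ExpPoly.smul (ExpPoly.prod _ (fun i n => x n i ^ m i) fun i hi => ?_) _
  exact (h i ((MvPolynomial.mem_vars i).2 ⟨m, hm, hi⟩)).pow _

/-- Eventually constant sign. -/
def EvSign (f : ℕ → ℝ) : Prop :=
  (∀ᶠ n in atTop, 0 < f n) ∨ (∀ᶠ n in atTop, f n = 0) ∨ (∀ᶠ n in atTop, f n < 0)

lemma evSign_of_le (f : ℕ → ℝ) (c : ℝ) (hc : 0 < c)
    (h : ∀ᶠ n in atTop, c * f n ≤ f (n + 1)) : EvSign f := by
  obtain ⟨N, hN⟩ := eventually_atTop.1 h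
  by_cases h1 : ∃ m ≥ N, 0 < f m
  · obtain ⟨m, hm, hp⟩ := h1
    left
    refine eventually_atTop.2 ⟨m, fun n hn => ?_⟩
    induction n, hn using Nat.le_induction with
    | base => exact hp
    | succ n hn ih => exact (mul_pos hc ih).trans_le (hN n (hm.trans hn))
  push Not at h1
  by_cases h2 : ∃ m ≥ N, f m = 0
  · obtain ⟨m, hm, hp⟩ := h2
    right; left
    refine eventually_atTop.2 ⟨m, fun n hn => ?_⟩
    induction n, hn using Nat.le_induction with
    | base => exact hp
    | succ n hn ih =>
      have := hN n (hm.trans hn)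
      rw [ih, mul_zero] at this
      exact le_antisymm (h1 _ (by omega)) this
  push Not at h2
  right; right
  exact eventually_atTop.2 ⟨N, fun n hn => lt_of_le_of_ne (h1 n hn) (h2 n hn)⟩

lemma EvSign.of_neg {f : ℕ → ℝ} (h : EvSign fun n => -f n) : EvSign f := by
  simp only [EvSign, neg_pos, neg_eq_zero, neg_lt_zero] at h
  unfold EvSign
  tauto

lemma eventually_of_succ {P : ℕ → Prop} (h : ∀ᶠ n in atTop, P (n + 1)) :
    ∀ᶠ n in atTop, P n := by
  obtain ⟨N, hN⟩ := eventually_atTop.1 h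
  refine eventually_atTop.2 ⟨N + 1, fun n hn => ?_⟩
  obtain ⟨m, rfl⟩ : ∃ m, n = m + 1 := ⟨n - 1, by omega⟩
  exact hN m (by omega)

lemma ExpPoly.evSign {f : ℕ → ℝ} (hf : ExpPoly f) : EvSign f := by
  induction hf with
  | zero f h => exact Or.inr (Or.inl h)
  | step f c hc h ih =>
    rcases hc.eq_or_lt with rfl | hc
    · simp only [zero_mul, sub_zero, EvSign] at ih
      rcases ih with h | h | h
      · exact Or.inl (eventually_of_succ h)
      · exact Or.inr (Or.inl (eventually_of_succ (P := fun n => f n = 0) h))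
      · exact Or.inr (Or.inr (eventually_of_succ (P := fun n => f n < 0) h))
    · rcases ih with h | h | h
      · exact evSign_of_le f c hc (h.mono fun n hn => by linarith)
      · exact evSign_of_le f c hc (h.mono fun n hn => by linarith)
      · exact EvSign.of_neg (evSign_of_le _ c hc (h.mono fun n hn => by linarith))

lemma expPoly_orbit {d : ℕ} (a : Fin d → MvPolynomial (Fin d) ℝ)
    (hwf : WellFounded (depRel a))
    (htnn : ∀ i, ∃ (ci : ℝ) (pi : MvPolynomial (Fin d) ℝ),
      0 ≤ ci ∧ i ∉ pi.vars ∧ a i = ci • X i + pi) (c : Fin d → ℝ) (i : Fin d) :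
    ExpPoly fun n => (updMap a)^[n] c i := by
  classical
  have hwf' : WellFounded (Function.swap (depRel a)) := by
    haveI : IsTrans (Fin d) (Function.swap (depRel a)) :=
      ⟨fun x y z h1 h2 => Relation.TransGen.trans h2 h1⟩
    haveI : Std.Irrefl (Function.swap (depRel a)) :=
      ⟨fun x h => hwf.isIrrefl.irrefl x h⟩
    exact Finite.wellFounded_of_trans_of_irrefl _
  induction i using hwf'.induction with
  | h i ih =>
    obtain ⟨r, p, hr, hp, ha⟩ := htnn i
    refine .step _ r hr ?_
    have hE : ExpPoly fun n => MvPolynomial.eval ((updMap a)^[n] c) p := by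
      refine ExpPoly.eval p _ fun j hj => ih j (Relation.TransGen.single ?_)
      have hij : i ≠ j := by rintro rfl; exact hp hj
      refine ⟨hij, ?_⟩
      obtain ⟨m, hm, hjm⟩ := (MvPolynomial.mem_vars j).1 hj
      refine (MvPolynomial.mem_vars j).2 ⟨m, ?_, hjm⟩
      rw [MvPolynomial.mem_support_iff] at hm ⊢
      have hne : Finsupp.single i 1 ≠ m := by
        rintro rfl
        simp at hjm
        exact hij hjm.symm
      rw [ha, coeff_add, coeff_smul, coeff_X', if_neg hne]
      simpa using hm
    refine hE.congr _ (Eventually.of_forall fun n => ?_)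
    rw [Function.iterate_succ_apply']
    simp [updMap, ha, smul_eval]

lemma evDec_guard {d : ℕ} (x : ℕ → Fin d → ℝ) (hx : ∀ i, ExpPoly fun n => x n i)
    (S : Set (Fin d → ℝ)) (hS : IsDNFGuard S) :
    (∀ᶠ n in atTop, x n ∈ S) ∨ (∀ᶠ n in atTop, x n ∉ S) := by
  obtain ⟨m, k, p, st, rfl⟩ := hS
  simp only [Set.mem_iUnion, Set.mem_iInter, Set.mem_setOf_eq]
  have hatom : ∀ i j,
      (∀ᶠ n in atTop, if st i j then 0 < eval (x n) (p i j) else 0 ≤ eval (x n) (p i j)) ∨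
      (∀ᶠ n in atTop, ¬ if st i j then 0 < eval (x n) (p i j) else 0 ≤ eval (x n) (p i j)) := by
    intro i j
    have := (ExpPoly.eval (p i j) x fun i _ => hx i).evSign
    cases st i j <;> simp only [if_true, Bool.false_eq_true, if_false, not_lt, not_le]
    · rcases this with h | h | h
      · exact Or.inl (h.mono fun n hn => hn.le)
      · exact Or.inl (h.mono fun n hn => hn.ge)
      · exact Or.inr h
    · rcases this with h | h | h
      · exact Or.inl h
      · exact Or.inr (h.mono fun n hn => hn.le)
      · exact Or.inr (h.mono fun n hn => hn.le)
  by_cases H : ∃ i, ∀ j,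
      ∀ᶠ n in atTop, if st i j then 0 < eval (x n) (p i j) else 0 ≤ eval (x n) (p i j)
  · obtain ⟨i, hi⟩ := H
    left
    exact (eventually_all.2 hi).mono fun n hn => ⟨i, hn⟩
  · right
    have H' : ∀ i, ∀ᶠ n in atTop, ¬ ∀ j,
        if st i j then 0 < eval (x n) (p i j) else 0 ≤ eval (x n) (p i j) := by
      intro i
      obtain ⟨j, hj⟩ := not_forall.1 (not_exists.1 H i)
      exact ((hatom i j).resolve_left hj).mono fun n hn h => hn (h j)
    exact (eventually_all.2 H').mono fun n hn ⟨i, hi⟩ => hn i hi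

lemma nonterm_of_eventually {d : ℕ} (f : (Fin d → ℝ) → Fin d → ℝ) (c : Fin d → ℝ)
    (S : Set (Fin d → ℝ)) (h : ∀ᶠ n in atTop, f^[n] c ∈ S) : ∃ c, ∀ n : ℕ, f^[n] c ∈ S := by
  obtain ⟨N, hN⟩ := eventually_atTop.1 h
  refine ⟨f^[N] c, fun n => ?_⟩
  rw [← Function.iterate_add_apply]
  exact hN _ (by omega)

/-- For tnn-loops, non-termination distributes over disjunction in the guard: the loop
with guard `S ∪ S'` is non-terminating iff the loop with guard `S` is non-terminating or
the loop with guard `S'` is non-terminating. -/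
theorem tnn_nontermination_union {d : ℕ} (hd : 1 ≤ d)
    (a : Fin d → MvPolynomial (Fin d) ℝ)
    (hwf : WellFounded (depRel a))
    (htnn : ∀ i, ∃ (ci : ℝ) (pi : MvPolynomial (Fin d) ℝ),
      0 ≤ ci ∧ i ∉ pi.vars ∧ a i = ci • X i + pi)
    (S S' : Set (Fin d → ℝ)) (hS : IsDNFGuard S) (hS' : IsDNFGuard S') :
    (∃ c : Fin d → ℝ, ∀ n : ℕ, (updMap a)^[n] c ∈ S ∪ S') ↔
      ((∃ c : Fin d → ℝ, ∀ n : ℕ, (updMap a)^[n] c ∈ S) ∨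
       (∃ c : Fin d → ℝ, ∀ n : ℕ, (updMap a)^[n] c ∈ S')) := by
  constructor
  · rintro ⟨c, hc⟩
    rcases evDec_guard _ (expPoly_orbit a hwf htnn c) S hS with h | h
    · exact Or.inl (nonterm_of_eventually _ c S h)
    · exact Or.inr (nonterm_of_eventually _ c S' (h.mono fun n hn => (hc n).resolve_left hn))
  · rintro (⟨c, hc⟩ | ⟨c, hc⟩)
    · exact ⟨c, fun n => Or.inl (hc n)⟩
    · exact ⟨c, fun n => Or.inr (hc n)⟩
end

section
/- Let a : Fin d → MvPolynomial (Fin d) ℝ be an update and let J be the Jacobian matrix of a − x, i.e., J : Matrix (Fin d) (Fin d) (MvPolynomial (Fin d) ℝ) with J i j = pderiv j (a i − X i). For each k : Fin d let J^{(k)} be the matrix over MvPolynomial (Fin d × Fin d) ℝ obtained from J by renaming each variable v to the fresh variable (k, v). Then the following are equivalent: (1) J is strongly nilpotent, i.e., the ordered matrix product J^{(0)} · J^{(1)} · ⋯ · J^{(d−1)} is the zero matrix; (2) there exists an invertible matrix T : Matrix (Fin d) (Fin d) ℝ such that, for the linear ℝ-algebra automorphism η of MvPolynomial (Fin d) ℝ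 determined by η(X i) = Σ_j T i j • X j, the transformed update Tr_η(a), given by Tr_η(a) i = η⁻¹((aeval a)(η (X i))), satisfies for every i : Fin d that Tr_η(a) i = X i + p_i for some p_i ∈ MvPolynomial (Fin d) ℝ with p_i.vars ⊆ {j | j > i}. In particular, in case (2) the transformed update is twn. -/
open MvPolynomial

/-- The transformed update `Tr_η(a) i = η⁻¹((aeval a)(η (X i)))`. -/
noncomputable def Tr {d : ℕ}
    (η : MvPolynomial (Fin d) ℝ ≃ₐ[ℝ] MvPolynomial (Fin d) ℝ)
    (a : Fin d → MvPolynomial (Fin d) ℝ) (i : Fin d) : MvPolynomial (Fin d) ℝ :=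
  η.symm (aeval a (η (X i)))

/-- The ordered product `J⁽⁰⁾ · J⁽¹⁾ ⋯ J⁽ᵈ⁻¹⁾`, where `J⁽ᵏ⁾` is obtained from `J` by
renaming each variable `v` to the fresh variable `(k, v)`. `J` is strongly nilpotent iff
this product is the zero matrix. -/
noncomputable def strongProd {d : ℕ} (J : Matrix (Fin d) (Fin d) (MvPolynomial (Fin d) ℝ)) :
    Matrix (Fin d) (Fin d) (MvPolynomial (Fin d × Fin d) ℝ) :=
  ((List.finRange d).map fun k => J.map ⇑(rename fun v => (k, v))).prod


namespace StrongNil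

open scoped Matrix

lemma chain {d : ℕ} (φ : MvPolynomial (Fin d) ℝ →ₐ[ℝ] MvPolynomial (Fin d) ℝ) (k : Fin d)
    (f : MvPolynomial (Fin d) ℝ) :
    pderiv k (φ f) = ∑ l, φ (pderiv l f) * pderiv k (φ (X l)) := by
  induction f using MvPolynomial.induction_on with
  | C a =>
    have h : φ (C a) = C a := φ.commutes a
    simp [h]
  | add p q hp hq => simp [hp, hq, add_mul, Finset.sum_add_distrib]
  | mul_X p n h =>
    simp only [map_mul, Derivation.leibniz, smul_eq_mul, map_add, pderiv_X, h, add_mul,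
      Finset.sum_add_distrib]
    congr 1
    · rw [Finset.sum_eq_single n]
      · simp
      · intro b _ hb
        simp [Pi.single_eq_of_ne hb.symm]
      · simp
    · rw [Finset.mul_sum]
      exact Finset.sum_congr rfl fun l _ => by ring

lemma notMem_vars_of_pderiv_eq_zero {d : ℕ} {p : MvPolynomial (Fin d) ℝ} {j : Fin d}
    (h : pderiv j p = 0) : j ∉ p.vars := by
  intro hj
  rw [mem_vars_iff_mem_support] at hj
  obtain ⟨m, hm, hjm⟩ := hj
  have h1 := coeff_pderiv (i := j) p (m - Finsupp.single j 1)
  have h2 : m - Finsupp.single j 1 + Finsupp.single j 1 = m :=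
    Finsupp.sub_add_single_one_cancel (Finsupp.mem_support_iff.1 hjm)
  rw [h, h2, coeff_zero] at h1
  rcases mul_eq_zero.1 h1.symm with h3 | h3
  · exact (mem_support_iff.1 hm) h3
  · exact absurd h3 (by positivity)

lemma list_prod_strict {R : Type*} [CommRing R] {d : ℕ} (l : List (Matrix (Fin d) (Fin d) R))
    (h : ∀ N ∈ l, ∀ i j : Fin d, j ≤ i → N i j = 0) :
    ∀ i j : Fin d, (j : ℕ) < i + l.length → l.prod i j = 0 := by
  induction l with
  | nil =>
    intro i j hij
    simp only [List.length_nil, add_zero] at hij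
    simp only [List.prod_nil]
    exact Matrix.one_apply_ne (fun h => by subst h; omega)
  | cons N l ih =>
    intro i j hij
    rw [List.prod_cons, Matrix.mul_apply]
    refine Finset.sum_eq_zero fun k _ => ?_
    by_cases hk : k ≤ i
    · rw [h N (by simp) i k hk, zero_mul]
    · rw [ih (fun N' hN' => h N' (by simp [hN'])) k j, mul_zero]
      have : (i : ℕ) < k := by simpa using hk
      simp only [List.length_cons] at hij
      omega

lemma list_prod_conj {ι R : Type*} [Ring R] (S T : R) (hST : S * T = 1) (hTS : T * S = 1)
    (f g : ι → R) (l : List ι) (h : ∀ k, f k = S * g k * T) :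
    (l.map f).prod = S * (l.map g).prod * T := by
  induction l with
  | nil => simp [hST]
  | cons k l ih =>
    simp only [List.map_cons, List.prod_cons, ih, h]
    calc S * g k * T * (S * (l.map g).prod * T) = S * g k * (T * S) * (l.map g).prod * T := by
          noncomm_ring
      _ = _ := by rw [hTS]; noncomm_ring

/-- Flag construction. -/
lemma exists_flag {V I : Type*} [AddCommGroup V] [Module ℝ V] [FiniteDimensional ℝ V]
    (A : I → V →ₗ[ℝ] V) (n : ℕ)
    (hA : ∀ l : List I, l.length = n → (l.map A).prod = 0) (m : ℕ)
    (hm : m ≤ Module.finrank ℝ V) :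
    ∃ b : Fin m → V, LinearIndependent ℝ b ∧
      ∀ (v : I) (j : Fin m), A v (b j) ∈ Submodule.span ℝ (b '' Set.Iio j) := by
  induction m with
  | zero => exact ⟨Fin.elim0, linearIndependent_empty_type, fun _ j => j.elim0⟩
  | succ m ih =>
    obtain ⟨b, hb, hAb⟩ := ih (by omega)
    set U := Submodule.span ℝ (Set.range b) with hU
    have hUtop : U ≠ ⊤ := by
      intro h
      have h1 : Module.finrank ℝ U = m := by
        rw [hU, finrank_span_eq_card hb, Fintype.card_fin]
      rw [h, finrank_top] at h1
      omega
    obtain ⟨w, hw, hAw⟩ : ∃ w, w ∉ U ∧ ∀ v, A v w ∈ U := by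
      by_contra! hcon
      obtain ⟨v0, hv0⟩ : ∃ v0, v0 ∉ U := by
        by_contra! h
        exact hUtop (Submodule.eq_top_iff'.2 h)
      have key : ∀ k, ∃ l : List I, l.length = k ∧ (l.map A).prod v0 ∉ U := by
        intro k
        induction k with
        | zero => exact ⟨[], rfl, by simpa using hv0⟩
        | succ k ihk =>
          obtain ⟨l, hl, hlU⟩ := ihk
          obtain ⟨v, hv⟩ := hcon _ hlU
          exact ⟨v :: l, by simp [hl], by simpa using hv⟩
      obtain ⟨l, hl, hlU⟩ := key n
      rw [hA l hl] at hlU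
      exact hlU (by simp)
    refine ⟨Fin.snoc b w, ?_, ?_⟩
    · rw [linearIndependent_finSucc']
      simp only [Fin.init_snoc, Fin.snoc_last]
      exact ⟨hb, hw⟩
    · intro v j
      refine Fin.lastCases ?_ (fun j => ?_) j
      · rw [Fin.snoc_last]
        refine Submodule.span_mono ?_ (hAw v)
        rintro _ ⟨i, rfl⟩
        exact ⟨i.castSucc, Fin.castSucc_lt_last i, by simp⟩
      · rw [Fin.snoc_castSucc]
        refine Submodule.span_mono ?_ (hAb v j)
        rintro _ ⟨i, hi, rfl⟩
        exact ⟨i.castSucc, by simpa using hi, by simp⟩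

lemma exists_conj {d : ℕ} {I : Type*} (A : I → Matrix (Fin d) (Fin d) ℝ)
    (hA : ∀ l : List I, l.length = d → (l.map A).prod = 0) :
    ∃ S T : Matrix (Fin d) (Fin d) ℝ, S * T = 1 ∧ T * S = 1 ∧
      ∀ v i j, j ≤ i → (T * A v * S) i j = 0 := by
  obtain ⟨b, hb, hAb⟩ := exists_flag (V := Fin d → ℝ) (fun v => Matrix.toLin' (A v)) d
    (by
      intro l hl
      have h := congrArg (Matrix.toLinAlgEquiv' (R := ℝ) (n := Fin d)) (hA l hl)
      rw [map_list_prod, map_zero, List.map_map] at h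
      exact h) d (by simp)
  let S : Matrix (Fin d) (Fin d) ℝ := Matrix.of fun i j => b j i
  have hS : IsUnit S := by
    rw [← Matrix.linearIndependent_cols_iff_isUnit]
    exact hb
  have hdet := (Matrix.isUnit_iff_isUnit_det S).1 hS
  refine ⟨S, S⁻¹, Matrix.mul_nonsing_inv S hdet, Matrix.nonsing_inv_mul S hdet, ?_⟩
  intro v i j hij
  obtain ⟨c, hc0, hc⟩ : ∃ c : Fin d → ℝ, (∀ i, j ≤ i → c i = 0) ∧ S.mulVec c = A v *ᵥ b j := by
    have h := hAb v j
    rw [Finsupp.mem_span_image_iff_linearCombination] at h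
    obtain ⟨c, hc, h⟩ := h
    refine ⟨c, fun i hi => ?_, ?_⟩
    · by_contra hne
      have := hc (Finsupp.mem_support_iff.2 hne)
      exact absurd this (by simpa using hi)
    · rw [Finsupp.linearCombination_apply, Finsupp.sum_fintype _ _ (by simp)] at h
      rw [Matrix.toLin'_apply] at h
      rw [← h]
      ext k
      simp [S, Matrix.mulVec, dotProduct, mul_comm]
  have h1 : (S⁻¹ * A v * S) i j = (S⁻¹ *ᵥ (A v *ᵥ b j)) i := by
    rw [Matrix.mulVec_mulVec]
    rfl
  rw [h1, ← hc, Matrix.mulVec_mulVec, Matrix.nonsing_inv_mul S hdet, Matrix.one_mulVec]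
  exact hc0 i hij

lemma linsub {d : ℕ} (φ : MvPolynomial (Fin d) ℝ →ₐ[ℝ] MvPolynomial (Fin d) ℝ)
    (S T : Matrix (Fin d) (Fin d) ℝ) (hST : S * T = 1)
    (hφ : ∀ i, φ (X i) = ∑ j, T i j • X j) (i : Fin d) :
    φ (∑ j, S i j • X j) = X i := by
  simp only [map_sum, map_smul, hφ, Finset.smul_sum, smul_smul]
  rw [Finset.sum_comm]
  simp only [← Finset.sum_smul, ← Matrix.mul_apply, hST]
  simp [Matrix.one_apply]

/-- The Jacobian matrix of `a - x`. -/
noncomputable def Jac {d : ℕ} (a : Fin d → MvPolynomial (Fin d) ℝ) :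
    Matrix (Fin d) (Fin d) (MvPolynomial (Fin d) ℝ) :=
  Matrix.of fun i j => pderiv j (a i - X i)

lemma jac_tr {d : ℕ} (a : Fin d → MvPolynomial (Fin d) ℝ)
    (η : MvPolynomial (Fin d) ℝ ≃ₐ[ℝ] MvPolynomial (Fin d) ℝ)
    (S T : Matrix (Fin d) (Fin d) ℝ)
    (hη : ∀ i, η (X i) = ∑ j, T i j • X j) (hη' : ∀ i, η.symm (X i) = ∑ j, S i j • X j) :
    Jac (Tr η a) = T.map C * (Jac a).map η.symm * S.map C := by
  ext1 i k
  have h1 : Tr η a i - X i = η.symm (∑ j, T i j • (a j - X j)) := by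
    have h2 : (X i : MvPolynomial (Fin d) ℝ) = η.symm (∑ j, T i j • X j) := by
      rw [← hη, AlgEquiv.symm_apply_apply]
    have h4 : Tr η a i = η.symm (∑ j, T i j • a j) := by
      rw [Tr, hη]
      simp only [map_sum, map_smul, aeval_X]
    simp only [smul_sub, Finset.sum_sub_distrib]
    rw [map_sub, ← h2, h4]
  have h3 := chain (η.symm : MvPolynomial (Fin d) ℝ →ₐ[ℝ] MvPolynomial (Fin d) ℝ) k
    (∑ j, T i j • (a j - X j))
  simp only [AlgEquiv.coe_toAlgHom] at h3
  rw [Jac, Matrix.of_apply, h1, h3, Matrix.mul_apply]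
  refine Finset.sum_congr rfl fun l _ => ?_
  congr 1
  · rw [Matrix.mul_apply, map_sum, map_sum]
    refine Finset.sum_congr rfl fun j _ => ?_
    rw [Derivation.map_smul, map_smul, smul_eq_C_mul]
    rfl
  · rw [hη', map_sum]
    simp only [Derivation.map_smul, pderiv_X, Matrix.map_apply]
    rw [Finset.sum_eq_single k]
    · simp [smul_eq_C_mul]
    · intro j _ hj
      simp [Pi.single_eq_of_ne hj]
    · simp

lemma forward {d : ℕ} (a : Fin d → MvPolynomial (Fin d) ℝ) (h : strongProd (Jac a) = 0) :
    ∃ T : Matrix (Fin d) (Fin d) ℝ, IsUnit T ∧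
        ∃ η : MvPolynomial (Fin d) ℝ ≃ₐ[ℝ] MvPolynomial (Fin d) ℝ,
          (∀ i, η (X i) = ∑ j, T i j • X j) ∧
          ∀ i, ∃ p : MvPolynomial (Fin d) ℝ, (∀ j ∈ p.vars, i < j) ∧
            Tr η a i = X i + p := by
  obtain ⟨S, T, hST, hTS, hstr⟩ := exists_conj
    (fun v : Fin d → ℝ => (Jac a).map (eval v)) (by
      intro l hl
      have h1 := congrArg (RingHom.mapMatrix (m := Fin d)
        (eval (fun kv : Fin d × Fin d => l.get (kv.1.cast hl.symm) kv.2))) h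
      rw [strongProd, map_list_prod, map_zero, List.map_map] at h1
      rw [← h1]
      congr 1
      have h2 : l = (List.finRange d).map fun k => l.get (k.cast hl.symm) :=
        List.ext_getElem (by simp [hl]) (by simp)
      conv_lhs => rw [h2, List.map_map]
      refine List.map_congr_left fun k _ => ?_
      ext i j
      simp [eval_rename, Function.comp_def])
  have hl1 := linsub (aeval fun i => ∑ j, T i j • X j) S T hST (by simp)
  have hl2 := linsub (aeval fun i => ∑ j, S i j • X j) T S hTS (by simp)
  let η : MvPolynomial (Fin d) ℝ ≃ₐ[ℝ] MvPolynomial (Fin d) ℝ :=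
    AlgEquiv.ofAlgHom (aeval fun i => ∑ j, T i j • X j) (aeval fun i => ∑ j, S i j • X j)
      (by ext1 i; simpa only [AlgHom.comp_apply, aeval_X, AlgHom.id_apply] using hl1 i)
      (by ext1 i; simpa only [AlgHom.comp_apply, aeval_X, AlgHom.id_apply] using hl2 i)
  have hη : ∀ i, η (X i) = ∑ j, T i j • X j := fun i => aeval_X _ i
  have hη' : ∀ i, η.symm (X i) = ∑ j, S i j • X j := fun i => aeval_X _ i
  refine ⟨T, IsUnit.of_mul_eq_one S hTS, η, hη, fun i => ⟨Tr η a i - X i, ?_, by ring⟩⟩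
  intro j hj
  by_contra hij
  refine notMem_vars_of_pderiv_eq_zero ?_ hj
  have h1 : pderiv j (Tr η a i - X i) = Jac (Tr η a) i j := rfl
  rw [h1, jac_tr a η S T hη hη']
  apply MvPolynomial.funext
  intro v
  have h2 : ∀ f, eval v (η.symm f) = eval (S *ᵥ v) f := by
    intro f
    have : (aeval v : MvPolynomial (Fin d) ℝ →ₐ[ℝ] ℝ).comp η.symm.toAlgHom = aeval (S *ᵥ v) := by
      ext1 k
      simp [hη', Matrix.mulVec, dotProduct, smul_eq_C_mul]
    have h3 := DFunLike.congr_fun this f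
    simpa [aeval_eq_eval] using h3
  have h4 : (eval v).mapMatrix (T.map C * (Jac a).map η.symm * S.map C)
      = T * (Jac a).map (eval (S *ᵥ v)) * S := by
    rw [map_mul, map_mul]
    refine congrArg₂ (· * ·) (congrArg₂ (· * ·) ?_ ?_) ?_
    · ext; simp
    · ext; simp [h2]
    · ext; simp
  have h5 := congrFun (congrFun h4 i) j
  rw [hstr _ i j (not_lt.1 hij)] at h5
  simpa using h5

lemma backward {d : ℕ} (a : Fin d → MvPolynomial (Fin d) ℝ)
    (T : Matrix (Fin d) (Fin d) ℝ) (hT : IsUnit T)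
    (η : MvPolynomial (Fin d) ℝ ≃ₐ[ℝ] MvPolynomial (Fin d) ℝ)
    (hη : ∀ i, η (X i) = ∑ j, T i j • X j)
    (hp : ∀ i, ∃ p : MvPolynomial (Fin d) ℝ, (∀ j ∈ p.vars, i < j) ∧ Tr η a i = X i + p) :
    strongProd (Jac a) = 0 := by
  have hdet := (Matrix.isUnit_iff_isUnit_det T).1 hT
  obtain ⟨S, hST, hTS⟩ : ∃ S, S * T = 1 ∧ T * S = 1 :=
    ⟨T⁻¹, Matrix.nonsing_inv_mul T hdet, Matrix.mul_nonsing_inv T hdet⟩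
  have hη' : ∀ i, η.symm (X i) = ∑ j, S i j • X j := by
    intro i
    rw [AlgEquiv.symm_apply_eq]
    exact (linsub (η : MvPolynomial (Fin d) ℝ →ₐ[ℝ] MvPolynomial (Fin d) ℝ) S T hST hη i).symm
  have hJ := jac_tr a η S T hη hη'
  have hstr : ∀ i j, j ≤ i → Jac (Tr η a) i j = 0 := by
    intro i j hij
    obtain ⟨p, hp1, hp2⟩ := hp i
    rw [Jac, Matrix.of_apply, hp2, add_sub_cancel_left]
    exact pderiv_eq_zero_of_notMem_vars fun h => absurd (hp1 j h) (not_lt.2 hij)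
  let CC : Matrix (Fin d) (Fin d) ℝ →+* Matrix (Fin d) (Fin d) (MvPolynomial (Fin d × Fin d) ℝ) :=
    (C).mapMatrix
  let ρ : Fin d → MvPolynomial (Fin d) ℝ →ₐ[ℝ] MvPolynomial (Fin d × Fin d) ℝ :=
    fun k => rename fun v => (k, v)
  let N : Fin d → Matrix (Fin d) (Fin d) (MvPolynomial (Fin d × Fin d) ℝ) :=
    fun k => (Jac (Tr η a)).map fun f => ρ k (η f)
  have h1 : CC S * CC T = 1 := by rw [← map_mul, hST, map_one]
  have h2 : CC T * CC S = 1 := by rw [← map_mul, hTS, map_one]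
  have hN : ∀ k, N k = CC T * (Jac a).map (ρ k) * CC S := by
    intro k
    have h3 := congrArg (RingHom.mapMatrix (m := Fin d)
      ((ρ k).comp η.toAlgHom).toRingHom) hJ
    rw [map_mul, map_mul] at h3
    refine Eq.trans (Eq.trans ?_ h3) ?_
    · ext1 i j; simp [N]
    · have hC : ∀ r : ℝ, η (C r) = C r := fun r => η.commutes r
      refine congrArg₂ (· * ·) (congrArg₂ (· * ·) ?_ ?_) ?_
      · ext1 i j; simp [CC, ρ, hC]
      · ext1 i j; simp
      · ext1 i j; simp [CC, ρ, hC]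
  rw [strongProd, list_prod_conj (CC S) (CC T) h1 h2 _ N]
  · have : ((List.finRange d).map N).prod = 0 := by
      ext1 i j
      refine list_prod_strict _ ?_ i j ?_
      · intro M hM i j hij
        obtain ⟨k, -, rfl⟩ := List.mem_map.1 hM
        simp [N, hstr i j hij]
      · simp only [List.length_map, List.length_finRange]; omega
    rw [this]; simp
  · intro k
    rw [hN]
    calc (Jac a).map (ρ k) = (CC S * CC T) * (Jac a).map (ρ k) * (CC S * CC T) := by
          rw [h1]; simp
      _ = _ := by noncomm_ring

end StrongNil

/-- The Jacobian matrix of `a − x` is strongly nilpotent iff there exists a linear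
automorphism `η` (given by an invertible matrix `T` via `η (X i) = Σ_j T i j • X j`) such
that `Tr_η(a) i = X i + p_i` with `p_i` only using variables `j > i`; in particular any
update of the latter form is twn. -/
theorem strongly_nilpotent_jacobian_iff_linear_triangularizable {d : ℕ} (hd : 1 ≤ d)
    (a : Fin d → MvPolynomial (Fin d) ℝ) :
    (strongProd (Matrix.of fun i j => pderiv j (a i - X i)) = 0 ↔
      ∃ T : Matrix (Fin d) (Fin d) ℝ, IsUnit T ∧
        ∃ η : MvPolynomial (Fin d) ℝ ≃ₐ[ℝ] MvPolynomial (Fin d) ℝ,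
          (∀ i, η (X i) = ∑ j, T i j • X j) ∧
          ∀ i, ∃ p : MvPolynomial (Fin d) ℝ, (∀ j ∈ p.vars, i < j) ∧
            Tr η a i = X i + p) ∧
    (∀ η : MvPolynomial (Fin d) ℝ ≃ₐ[ℝ] MvPolynomial (Fin d) ℝ,
      (∀ i, ∃ p : MvPolynomial (Fin d) ℝ, (∀ j ∈ p.vars, i < j) ∧ Tr η a i = X i + p) →
      WellFounded (depRel (Tr η a)) ∧
      ∀ i, ∃ (c : ℝ) (q : MvPolynomial (Fin d) ℝ), i ∉ q.vars ∧
        Tr η a i = c • X i + q) := by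
  refine ⟨⟨StrongNil.forward a, ?_⟩, ?_⟩
  · rintro ⟨T, hT, η, hη, hp⟩
    exact StrongNil.backward a T hT η hη hp
  · intro η hp
    constructor
    · have hlt : ∀ i j, depRel (Tr η a) i j → i < j := by
        intro i j hij
        have step : ∀ i j, i ≠ j ∧ j ∈ (Tr η a i).vars → i < j := by
          rintro i j ⟨hne, hj⟩
          obtain ⟨p, hp1, hp2⟩ := hp i
          rw [hp2] at hj
          rcases Finset.mem_union.1 (vars_add_subset _ _ hj) with h | h
          · rw [vars_X, Finset.mem_singleton] at h
            exact absurd h.symm hne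
          · exact hp1 j h
        induction hij with
        | single h => exact step _ _ h
        | tail _ h ih => exact ih.trans (step _ _ h)
      exact Subrelation.wf (fun {i j} h => hlt i j h) (wellFounded_lt (α := Fin d))
    · intro i
      obtain ⟨p, hp1, hp2⟩ := hp i
      exact ⟨1, p, fun h => lt_irrefl _ (hp1 i h), by rw [hp2, one_smul]⟩
end
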